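/- Let n and c be positive integers with c ≥ 3. There exists an n-vertex polyunsaturated SGK graph G with clique number c if and only if n ≥ binom(c, 2). Moreover, G may be chosen so that both G and its complement are comparability graphs. -/

import Mathlib

/-- `s` is an independent set of the graph `G`. -/
def IndepSet {V : Type*} (G : SimpleGraph V) (s : Set V) : Prop :=
  ∀ ⦃v⦄, v ∈ s → ∀ ⦃w⦄, w ∈ s → ¬ G.Adj v w

/-- `α_k(G)`: the maximum number of vertices in a union of `k` independent sets. -/
noncomputable def alphak {V : Type*} (G : SimpleGraph V) (k : ℕ) : ℕ :=
  sSup {n | ∃ A : Fin k → Set V, (∀ i, IndepSet G (A i)) ∧ (⋃ i, A i).ncard = n}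

/-- `ω_k(G)`: the maximum number of vertices in a union of `k` cliques. -/
noncomputable def omegak {V : Type*} (G : SimpleGraph V) (k : ℕ) : ℕ :=
  sSup {n | ∃ A : Fin k → Set V, (∀ i, G.IsClique (A i)) ∧ (⋃ i, A i).ncard = n}

/-- The clique number `ω(G)`. -/
noncomputable def cliqueNumber {V : Type*} (G : SimpleGraph V) : ℕ :=
  sSup {n | ∃ s : Set V, G.IsClique s ∧ s.ncard = n}

/-- The independence number `α(G)`. -/
noncomputable def indepNumber {V : Type*} (G : SimpleGraph V) : ℕ :=
  sSup {n | ∃ s : Set V, IndepSet G s ∧ s.ncard = n}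

/-- `f` encodes a partition of the vertices of `G` into cliques:
its (nonempty) fibers are the cliques. -/
def IsCliquePartition {V : Type*} (G : SimpleGraph V) (f : V → V) : Prop :=
  ∀ i : V, G.IsClique (f ⁻¹' {i})

/-- The `k`-norm of the partition encoded by `f`: `Σ_C min (k, |C|)`. -/
noncomputable def knorm {V : Type*} [Fintype V] (f : V → V) (k : ℕ) : ℕ :=
  ∑ i : V, min k (f ⁻¹' {i}).ncard

/-- `G` is a strong Greene–Kleitman (SGK) graph: every induced subgraph has, for every
positive `k`, a clique partition that is simultaneously `k`- and `k+1`-saturated. -/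
def SGK {V : Type*} [Fintype V] (G : SimpleGraph V) : Prop :=
  ∀ (s : Finset V) (k : ℕ), 0 < k →
    ∃ f : (↑s : Set V) → (↑s : Set V),
      IsCliquePartition (G.induce ↑s) f ∧
      knorm f k = alphak (G.induce ↑s) k ∧
      knorm f (k + 1) = alphak (G.induce ↑s) (k + 1)

/-- An SGK graph is polyunsaturated if no clique partition is simultaneously `k`- and
`l`-saturated for distinct nonconsecutive positive `k, l` below the clique number. -/
def PolyunsatG {V : Type*} [Fintype V] (G : SimpleGraph V) : Prop :=
  ∀ k l : ℕ, 0 < k → 0 < l → k < cliqueNumber G → l < cliqueNumber G →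
    (k + 2 ≤ l ∨ l + 2 ≤ k) →
    ¬ ∃ f : V → V, IsCliquePartition G f ∧ knorm f k = alphak G k ∧ knorm f l = alphak G l

/-- `G` is a comparability graph: adjacency is comparability in some partial order. -/
def IsComparabilityGraph {V : Type*} (G : SimpleGraph V) : Prop :=
  ∃ r : V → V → Prop, IsPartialOrder V r ∧ ∀ v w, G.Adj v w ↔ (v ≠ w ∧ (r v w ∨ r w v))

section Saturation

variable {V : Type*} [Fintype V]

lemma bddAbove_alphak (G : SimpleGraph V) (k : ℕ) :
    BddAbove {n | ∃ A : Fin k → Set V, (∀ i, IndepSet G (A i)) ∧ (⋃ i, A i).ncard = n} := by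
  refine ⟨Fintype.card V, ?_⟩
  rintro n ⟨A, -, rfl⟩
  rw [← Nat.card_eq_fintype_card]
  exact Set.ncard_le_card _

lemma ncard_le_alphak {G : SimpleGraph V} {k : ℕ} (A : Fin k → Set V)
    (hA : ∀ i, IndepSet G (A i)) : (⋃ i, A i).ncard ≤ alphak G k :=
  le_csSup (bddAbove_alphak G k) ⟨A, hA, rfl⟩

lemma exists_ncard_eq_alphak (G : SimpleGraph V) (k : ℕ) :
    ∃ A : Fin k → Set V, (∀ i, IndepSet G (A i)) ∧ (⋃ i, A i).ncard = alphak G k :=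
  Nat.sSup_mem (s := {n | ∃ A : Fin k → Set V, (∀ i, IndepSet G (A i)) ∧
    (⋃ i, A i).ncard = n}) ⟨_, fun _ => ∅, fun _ v hv => by simp at hv, rfl⟩
    (bddAbove_alphak G k)

lemma bddAbove_cliqueNumber (G : SimpleGraph V) :
    BddAbove {n | ∃ s : Set V, G.IsClique s ∧ s.ncard = n} := by
  refine ⟨Fintype.card V, ?_⟩
  rintro n ⟨A, -, rfl⟩
  rw [← Nat.card_eq_fintype_card]
  exact Set.ncard_le_card _

lemma exists_isClique_ncard_eq (G : SimpleGraph V) :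
    ∃ s : Set V, G.IsClique s ∧ s.ncard = cliqueNumber G :=
  Nat.sSup_mem (s := {n | ∃ s : Set V, G.IsClique s ∧ s.ncard = n})
    ⟨_, ∅, by simp, rfl⟩ (bddAbove_cliqueNumber G)

lemma ncard_eq_sum_fibers (f : V → V) (s : Set V) :
    s.ncard = ∑ z : V, (f ⁻¹' {z} ∩ s).ncard := by
  classical
  have h : ∀ t : Set V, t.ncard = (Finset.univ.filter (· ∈ t)).card := fun t => by
    rw [← Set.ncard_coe_finset]
    congr 1
    ext x
    simp
  rw [h, Finset.card_eq_sum_card_fiberwise (f := f) (t := Finset.univ) (by simp)]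
  refine Finset.sum_congr rfl fun z _ => ?_
  rw [h]
  congr 1
  ext x
  simp [and_comm]

lemma SimpleGraph.IsClique.ncard_inter_iUnion_le {G : SimpleGraph V} {Q : Set V}
    (hQ : G.IsClique Q) {k : ℕ} (A : Fin k → Set V) (hA : ∀ i, IndepSet G (A i)) :
    (Q ∩ ⋃ i, A i).ncard ≤ min k Q.ncard := by
  refine le_min ?_ (Set.ncard_le_ncard Set.inter_subset_left (Set.toFinite _))
  rw [Set.inter_iUnion]
  refine (Set.ncard_iUnion_le_of_fintype _).trans ?_
  refine (Finset.sum_le_card_nsmul _ _ 1 fun i _ => ?_).trans (by simp)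
  refine (Set.ncard_le_one (Set.toFinite _)).2 fun x hx y hy => ?_
  by_contra hxy
  exact hA i hx.2 hy.2 (hQ hx.1 hy.1 hxy)

lemma alphak_le_knorm {G : SimpleGraph V} {f : V → V} (hf : IsCliquePartition G f) (k : ℕ) :
    alphak G k ≤ knorm f k := by
  obtain ⟨A, hA, h⟩ := exists_ncard_eq_alphak G k
  rw [← h, ncard_eq_sum_fibers f]
  exact Finset.sum_le_sum fun z _ => (hf z).ncard_inter_iUnion_le A hA

lemma knorm_le_ncard_of_fibers {f : V → V} {k : ℕ} {U : Set V}
    (h : ∀ z, f ⁻¹' {z} ⊆ U ∨ k ≤ (f ⁻¹' {z} ∩ U).ncard) : knorm f k ≤ U.ncard := by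
  rw [ncard_eq_sum_fibers f]
  refine Finset.sum_le_sum fun z _ => ?_
  rcases h z with h | h
  · rw [Set.inter_eq_left.2 h]
    exact min_le_right _ _
  · exact (min_le_left _ _).trans h

lemma knorm_eq_card_of_le {f : V → V} {k : ℕ} (h : ∀ z, (f ⁻¹' {z}).ncard ≤ k) :
    knorm f k = Fintype.card V := by
  rw [← Nat.card_eq_fintype_card, ← Set.ncard_univ, ncard_eq_sum_fibers f]
  refine Finset.sum_congr rfl fun z _ => ?_
  rw [Set.inter_univ, min_eq_right (h z)]

/-- Complementary slackness: the fibers of a partition whose `k`-norm is attained by the vertices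
of colour less than `k` either avoid the colours `≥ k` or meet every colour below `k`. -/
lemma exists_color_of_knorm_le {G : SimpleGraph V} {f : V → V} (hf : IsCliquePartition G f)
    {ρ : V → ℕ} (hρ : ∀ x y, G.Adj x y → ρ x ≠ ρ y) {k : ℕ}
    (h : knorm f k ≤ {x | ρ x < k}.ncard) {x : V} (hx : k ≤ ρ x) {r : ℕ} (hr : r < k) :
    ∃ y, f y = f x ∧ ρ y = r := by
  set U : Set V := {x | ρ x < k}
  have hinj : ∀ z, Set.InjOn ρ (f ⁻¹' {z} ∩ U) := fun z a ha b hb hab => by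
    by_contra hne
    exact hρ a b (hf z ha.1 hb.1 hne) hab
  have himg : ∀ z, ρ '' (f ⁻¹' {z} ∩ U) ⊆ (Finset.range k : Set ℕ) := by
    rintro z _ ⟨a, ha, rfl⟩
    exact Finset.mem_coe.2 (Finset.mem_range.2 ha.2)
  have hle : ∀ z, (f ⁻¹' {z} ∩ U).ncard ≤ k := fun z => by
    rw [← (hinj z).ncard_image]
    refine (Set.ncard_le_ncard (himg z) (Finset.finite_toSet _)).trans ?_
    rw [Set.ncard_coe_finset, Finset.card_range]
  have hle' : ∀ z, (f ⁻¹' {z} ∩ U).ncard ≤ min k (f ⁻¹' {z}).ncard := fun z =>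
    le_min (hle z) (Set.ncard_le_ncard Set.inter_subset_left (Set.toFinite _))
  rw [ncard_eq_sum_fibers f U] at h
  have heq := (Finset.sum_eq_sum_iff_of_le fun z _ => hle' z).1
    (le_antisymm (Finset.sum_le_sum fun z _ => hle' z) h) (f x) (Finset.mem_univ _)
  have hlt : (f ⁻¹' {f x} ∩ U).ncard < (f ⁻¹' {f x}).ncard := by
    refine Set.ncard_lt_ncard ⟨Set.inter_subset_left, fun hs => ?_⟩ (Set.toFinite _)
    have : ρ x < k := (hs (show x ∈ f ⁻¹' {f x} from rfl)).2
    omega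
  have hk : (f ⁻¹' {f x} ∩ U).ncard = k := by omega
  have himg' : ρ '' (f ⁻¹' {f x} ∩ U) = (Finset.range k : Set ℕ) := by
    refine Set.eq_of_subset_of_ncard_le (himg _) ?_ (Finset.finite_toSet _)
    rw [(hinj _).ncard_image, hk, Set.ncard_coe_finset, Finset.card_range]
  have hr' : r ∈ ρ '' (f ⁻¹' {f x} ∩ U) := by
    rw [himg']
    simpa using hr
  obtain ⟨y, hy, hyr⟩ := hr'
  exact ⟨y, hy.1, hyr⟩

lemma alphak_le_of_iso {W : Type*} [Fintype W] {G : SimpleGraph V} {H : SimpleGraph W}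
    (e : G ≃g H) (k : ℕ) : alphak G k ≤ alphak H k := by
  obtain ⟨A, hA, h⟩ := exists_ncard_eq_alphak G k
  rw [← h, ← Set.ncard_image_of_injective _ e.injective, Set.image_iUnion]
  refine ncard_le_alphak _ fun i => ?_
  rintro _ ⟨v, hv, rfl⟩ _ ⟨w, hw, rfl⟩
  rw [e.map_adj_iff]
  exact hA i hv hw

lemma alphak_congr {W : Type*} [Fintype W] {G : SimpleGraph V} {H : SimpleGraph W}
    (e : G ≃g H) (k : ℕ) : alphak G k = alphak H k :=
  le_antisymm (alphak_le_of_iso e k) (alphak_le_of_iso e.symm k)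

lemma knorm_conj {W : Type*} [Fintype W] (e : W ≃ V) (f : W → W) (k : ℕ) :
    knorm (e ∘ f ∘ e.symm) k = knorm f k := by
  unfold knorm
  rw [← e.sum_comp]
  refine Finset.sum_congr rfl fun z _ => ?_
  congr 1
  rw [← Set.ncard_image_of_injective (f ⁻¹' {z}) e.injective]
  congr 1
  ext x
  simp

lemma IsCliquePartition.conj {U W : Type*} {G : SimpleGraph U} {H : SimpleGraph W} (e : H ≃g G)
    {f : W → W} (hf : IsCliquePartition H f) :
    IsCliquePartition G (e ∘ f ∘ e.symm) := by
  intro z x hx y hy hxy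
  rw [← e.symm.map_adj_iff]
  refine hf (e.symm z) ?_ ?_ (by simpa using hxy)
  · have : e (f (e.symm x)) = z := hx
    simp [← this]
  · have : e (f (e.symm y)) = z := hy
    simp [← this]

lemma SGK.exists_saturated {G : SimpleGraph V} (hG : SGK G) {k : ℕ} (hk : 0 < k) :
    ∃ f : V → V, IsCliquePartition G f ∧ knorm f k = alphak G k ∧
      knorm f (k + 1) = alphak G (k + 1) := by
  obtain ⟨f, hf, h1, h2⟩ := hG Finset.univ k hk
  have e : G.induce ((Finset.univ : Finset V) : Set V) ≃g G :=
    { toEquiv := (Equiv.subtypeUnivEquiv (by simp)), map_rel_iff' := by simp }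
  refine ⟨e ∘ f ∘ e.symm, hf.conj e, ?_, ?_⟩
  · rw [← alphak_congr e, ← h1]
    exact knorm_conj e.toEquiv f k
  · rw [← alphak_congr e, ← h2]
    exact knorm_conj e.toEquiv f (k + 1)

end Saturation

section LowerBound

variable {V : Type*} [Fintype V]

lemma knorm_succ (f : V → V) (k : ℕ) :
    knorm f (k + 1) = knorm f k +
      (Finset.univ.filter fun z => k + 1 ≤ (f ⁻¹' {z}).ncard).card := by
  rw [Finset.card_filter]
  unfold knorm
  rw [← Finset.sum_add_distrib]
  refine Finset.sum_congr rfl fun z _ => ?_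
  split_ifs <;> omega

lemma knorm_add_two_add_le (f : V → V) (k : ℕ) :
    knorm f (k + 2) + knorm f k ≤ 2 * knorm f (k + 1) := by
  have h1 := knorm_succ f k
  have h2 := knorm_succ f (k + 1)
  have h3 : (Finset.univ.filter fun z => k + 1 + 1 ≤ (f ⁻¹' {z}).ncard).card ≤
      (Finset.univ.filter fun z => k + 1 ≤ (f ⁻¹' {z}).ncard).card :=
    Finset.card_le_card fun z hz => by
      simp only [Finset.mem_filter, Finset.mem_univ, true_and] at hz ⊢
      omega
  rw [show k + 2 = k + 1 + 1 from rfl]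
  omega

lemma alphak_lt_card {G : SimpleGraph V} {k : ℕ} (hk : k < cliqueNumber G) :
    alphak G k < Fintype.card V := by
  obtain ⟨Q, hQ, hQc⟩ := exists_isClique_ncard_eq G
  obtain ⟨A, hA, h⟩ := exists_ncard_eq_alphak G k
  by_contra! hle
  have huniv : ⋃ i, A i = Set.univ := by
    refine Set.eq_of_subset_of_ncard_le (Set.subset_univ _) ?_ (Set.toFinite _)
    rw [Set.ncard_univ, Nat.card_eq_fintype_card, h]
    exact hle
  have := hQ.ncard_inter_iUnion_le A hA
  rw [huniv, Set.inter_univ] at this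
  omega

lemma choose_two_le_card_of_polyunsat {G : SimpleGraph V} {c : ℕ} (hc : 3 ≤ c) (hS : SGK G)
    (hP : PolyunsatG G) (hω : cliqueNumber G = c) : c.choose 2 ≤ Fintype.card V := by
  have hcard : ∀ f : V → V, IsCliquePartition G f → knorm f c = Fintype.card V := fun f hf =>
    knorm_eq_card_of_le fun z => hω ▸ le_csSup (bddAbove_cliqueNumber G) ⟨_, hf z, rfl⟩
  have hlast : alphak G (c - 1) + 1 ≤ Fintype.card V := alphak_lt_card (by omega)
  have hzero : ∀ f : V → V, knorm f 0 = 0 := fun f => by simp [knorm]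
  have hstep : ∀ k, 1 ≤ k → k + 3 ≤ c →
      alphak G (k + 2) + alphak G k + 1 ≤ 2 * alphak G (k + 1) := by
    intro k hk hkc
    obtain ⟨f, hf, h1, h2⟩ := hS.exists_saturated hk
    have h3 := alphak_le_knorm hf (k + 2)
    have h4 : knorm f (k + 2) ≠ alphak G (k + 2) := fun h =>
      hP k (k + 2) hk (by omega) (by omega) (by omega) (Or.inl le_rfl) ⟨f, hf, h1, h⟩
    have := knorm_add_two_add_le f k
    omega
  have hdiff : ∀ t, t + 3 ≤ c →
      alphak G (c - 2 - t) + t + 1 ≤ alphak G (c - 2 - t + 1) := by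
    intro t
    induction t with
    | zero =>
      intro _
      obtain ⟨f, hf, h1, h2⟩ := hS.exists_saturated (k := c - 2) (by omega)
      have := knorm_add_two_add_le f (c - 2)
      rw [show c - 2 + 2 = c by omega, hcard f hf] at this
      rw [show c - 2 + 1 = c - 1 by omega] at *
      rw [Nat.sub_zero, show c - 2 + 1 = c - 1 by omega]
      omega
    | succ t ih =>
      intro ht
      have h1 := ih (by omega)
      have h2 := hstep (c - 2 - (t + 1)) (by omega) (by omega)
      rw [show c - 2 - (t + 1) + 2 = c - 2 - t + 1 by omega,
        show c - 2 - (t + 1) + 1 = c - 2 - t by omega] at *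
      omega
  have hsum : ∀ t, t + 2 ≤ c →
      alphak G (c - 1 - t) + 1 + (t + 1).choose 2 ≤ Fintype.card V := by
    intro t
    induction t with
    | zero => intro _; simpa using hlast
    | succ t ih =>
      intro ht
      have h1 := ih (by omega)
      have h2 := hdiff t (by omega)
      rw [show c - 2 - t + 1 = c - 1 - t by omega] at h2
      rw [show c - 1 - (t + 1) = c - 2 - t by omega, Nat.choose_succ_succ' (t + 1) 1,
        Nat.choose_one_right, one_add_one_eq_two]
      omega
  have hone : c - 2 ≤ alphak G 1 := by
    obtain ⟨f, hf, h1, h2⟩ := hS.exists_saturated (k := 1) one_pos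
    have h3 := knorm_add_two_add_le f 0
    have h4 := hdiff (c - 3) (by omega)
    rw [show c - 2 - (c - 3) = 1 by omega] at h4
    simp only [zero_add, hzero] at h3
    rw [show 1 + 1 = 2 from rfl] at *
    omega
  have hfin := hsum (c - 2) (by omega)
  obtain ⟨d, rfl⟩ : ∃ d, c = d + 2 := ⟨c - 2, by omega⟩
  rw [show d + 2 - 1 - (d + 2 - 2) = 1 by omega, show d + 2 - 2 + 1 = d + 1 by omega] at hfin
  rw [Nat.choose_succ_succ' (d + 1) 1, Nat.choose_one_right, one_add_one_eq_two]
  omega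

end LowerBound

section GreeneKleitman

/-- Egerváry's theorem: integral strong duality for the assignment problem. -/
lemma exists_perm_potential {V : Type*} [Fintype V] (c : V → V → ℤ) :
    ∃ (σ : Equiv.Perm V) (a b : V → ℤ), (∀ x y, a x + b y ≤ c x y) ∧
      ∀ x, a x + b (σ x) = c x (σ x) := by
  classical
  obtain ⟨m, ⟨a, b, hab, hm⟩, hmax⟩ := Int.exists_greatest_of_bdd
    (P := fun m => ∃ a b : V → ℤ, (∀ x y, a x + b y ≤ c x y) ∧ ∑ x, a x + ∑ x, b x = m)
    ⟨∑ x, c x x, by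
      rintro m ⟨a, b, hab, rfl⟩
      rw [← Finset.sum_add_distrib]
      exact Finset.sum_le_sum fun x _ => hab x x⟩
    ⟨_, fun x => -∑ y, |c x y|, fun _ => 0, fun x y => by
      have h1 := Finset.single_le_sum (f := fun y => |c x y|) (fun y _ => abs_nonneg _)
        (Finset.mem_univ y)
      have h2 := neg_abs_le (c x y)
      linarith, rfl⟩
  let t : V → Finset V := fun x => Finset.univ.filter fun y => a x + b y = c x y
  by_cases hall : ∀ s : Finset V, s.card ≤ (s.biUnion t).card
  · obtain ⟨f, hf, hft⟩ := (Finset.all_card_le_biUnion_card_iff_exists_injective t).1 hall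
    refine ⟨Equiv.ofBijective f (Finite.injective_iff_bijective.1 hf), a, b, hab, fun x => ?_⟩
    simpa [t] using hft x
  · push Not at hall
    obtain ⟨s, hs⟩ := hall
    have := hmax _ ⟨fun x => a x + if x ∈ s then 1 else 0,
      fun y => b y - if y ∈ s.biUnion t then 1 else 0, fun x y => ?_, rfl⟩
    · simp only [Finset.sum_add_distrib, Finset.sum_sub_distrib, Finset.sum_ite_mem,
        Finset.univ_inter, Finset.sum_const, nsmul_eq_mul, mul_one] at this
      omega
    · have hxy := hab x y
      by_cases hx : x ∈ s
      · by_cases hy : y ∈ s.biUnion t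
        · simp only [hx, hy, if_true]
          omega
        · have : a x + b y ≠ c x y := fun h =>
            hy (Finset.mem_biUnion.2 ⟨x, hx, by simpa [t] using h⟩)
          simp only [hx, hy, if_true, if_false]
          omega
      · simp only [hx, if_false]
        split_ifs <;> omega

variable {V : Type*} {lt : V → V → Prop}

lemma lt_iterate_of_ascending (htr : ∀ x y z, lt x y → lt y z → lt x z) (σ : V → V) (x : V)
    {n : ℕ} (hn : 0 < n) (h : ∀ j < n, lt (σ^[j] x) (σ^[j + 1] x)) : lt x (σ^[n] x) := by
  induction n with
  | zero => omega
  | succ n ih =>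
    rcases Nat.eq_zero_or_pos n with rfl | hpos
    · exact h 0 hn
    · exact htr _ _ _ (ih hpos fun j hj => h j (by omega)) (h n (by omega))

/-- A permutation of a finite poset splits it into chains: follow the permutation as long as it
ascends. -/
lemma exists_chain_partition_of_perm [Finite V] (hirr : ∀ x, ¬ lt x x)
    (htr : ∀ x y z, lt x y → lt y z → lt x z) (σ : Equiv.Perm V) :
    ∃ f : V → V, (∀ x y, f x = f y → x = y ∨ lt x y ∨ lt y x) ∧
      (∀ x, ¬ lt (f x) (σ (f x))) ∧ ∀ x, σ (f x) = f x → x = f x := by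
  have hwf : WellFounded fun x y => lt y x := by
    have : IsTrans V fun x y => lt y x := ⟨fun x y z h1 h2 => htr z y x h2 h1⟩
    have : Std.Irrefl fun x y => lt y x := ⟨hirr⟩
    exact Finite.wellFounded_of_trans_of_irrefl _
  have hex : ∀ x, ∃ i : ℕ, ¬ lt (σ^[i] x) (σ (σ^[i] x)) ∧
      ∀ j < i, lt (σ^[j] x) (σ^[j + 1] x) := by
    intro x
    induction x using hwf.induction with
    | _ x ih =>
      by_cases hx : lt x (σ x)
      · obtain ⟨i, hi, hj⟩ := ih (σ x) hx
        refine ⟨i + 1, by simpa using hi, fun j hji => ?_⟩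
        cases j with
        | zero => exact hx
        | succ j => simpa using hj j (by omega)
      · exact ⟨0, hx, by simp⟩
  choose i hterm hasc using hex
  have key : ∀ x y, i x ≤ i y → σ^[i x] x = σ^[i y] y → x = y ∨ lt y x := by
    intro x y hle hxy
    obtain ⟨d, hd⟩ := Nat.exists_eq_add_of_le hle
    rw [hd, Function.iterate_add_apply] at hxy
    have hx := (σ.injective.iterate _) hxy
    rcases Nat.eq_zero_or_pos d with rfl | hpos
    · exact Or.inl hx
    · right
      rw [hx]
      exact lt_iterate_of_ascending htr σ y hpos fun j hj => hasc y j (by omega)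
  refine ⟨fun x => σ^[i x] x, fun x y hxy => ?_, hterm, fun x hx => ?_⟩
  · rcases le_total (i x) (i y) with h | h
    · rcases key x y h hxy with h | h <;> simp [h]
    · rcases key y x h hxy.symm with h | h <;> simp [h]
  · have : σ^[i x] (σ^[i x] x) = σ^[i x] x := Function.iterate_fixed hx _
    exact ((σ.injective.iterate _) this).symm

/-- The Greene–Kleitman theorem: a finite comparability graph has a clique partition that is
simultaneously `k`- and `k + 1`-saturated. -/
theorem exists_saturated_of_strictOrder [Fintype V] {G : SimpleGraph V}
    (hirr : ∀ x, ¬ lt x x) (htr : ∀ x y z, lt x y → lt y z → lt x z)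
    (hG : ∀ x y, G.Adj x y ↔ lt x y ∨ lt y x) {k : ℕ} (hk : 0 < k) :
    ∃ f : V → V, IsCliquePartition G f ∧ knorm f k = alphak G k ∧
      knorm f (k + 1) = alphak G (k + 1) := by
  classical
  obtain ⟨σ, a, b, hab, hσ⟩ := exists_perm_potential
    (fun x y : V => if x = y then (2 : ℤ) else if lt x y then 0 else 2 * k + 1)
  obtain ⟨f, hf, hterm, hfix⟩ := exists_chain_partition_of_perm hirr htr σ
  have hpart : IsCliquePartition G f := fun z x hx y hy hxy => by
    have : f x = f y := (show f x = z from hx).trans (show f y = z from hy).symm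
    rcases hf x y this with h | h
    · exact absurd h hxy
    · exact (hG x y).2 h
  have h2 : ∀ x, a x + b x ≤ 2 := fun x => by simpa using hab x x
  have h0 : ∀ x y, lt x y → a x + b y ≤ 0 := fun x y h => by
    have := hab x y
    rwa [if_neg (by rintro rfl; exact hirr _ h), if_pos h] at this
  have hK : ∀ x y, a x + b y ≤ 2 * k + 1 := fun x y => by
    have := hab x y
    split_ifs at this <;> omega
  obtain ⟨M, hM1, hM2⟩ : ∃ M : ℤ, (∀ x, M ≤ -a x) ∧ ∀ y, b y ≤ M + (2 * k + 1) := by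
    rcases isEmpty_or_nonempty V with h | h
    · exact ⟨0, fun x => h.elim x, fun x => h.elim x⟩
    · obtain ⟨x, hx⟩ := Finite.exists_min fun x => -a x
      exact ⟨-a x, hx, fun y => by have := hK x y; omega⟩
  let A : ℤ → Set V := fun t => {x | -a x ≤ t ∧ t < b x}
  have hA : ∀ t, IndepSet G (A t) := by
    intro t v hv w hw hvw
    have hv1 : -a v ≤ t ∧ t < b v := hv
    have hw1 : -a w ≤ t ∧ t < b w := hw
    rcases (hG v w).1 hvw with h | h
    · have := h0 _ _ h
      omega
    · have := h0 _ _ h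
      omega
  let O : Set V := ⋃ i : Fin k, A (M + 2 * (i : ℕ) + 1)
  let E : Set V := ⋃ i : Fin (k + 1), A (M + 2 * (i : ℕ))
  have hO : O.ncard ≤ alphak G k := ncard_le_alphak _ fun i => hA _
  have hE : E.ncard ≤ alphak G (k + 1) := ncard_le_alphak _ fun i => hA _
  have hmemO : ∀ x t, x ∈ A t → (t - M) % 2 = 1 → x ∈ O := by
    intro x t hx ht
    have hx1 : -a x ≤ t ∧ t < b x := hx
    have h3 := hM1 x
    have h4 := hM2 x
    refine Set.mem_iUnion.2 ⟨⟨((t - M) / 2).toNat, by omega⟩, ?_⟩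
    convert hx using 2
    simp only
    omega
  have hmemE : ∀ x t, x ∈ A t → (t - M) % 2 = 0 → x ∈ E := by
    intro x t hx ht
    have hx1 : -a x ≤ t ∧ t < b x := hx
    have h3 := hM1 x
    have h4 := hM2 x
    refine Set.mem_iUnion.2 ⟨⟨((t - M) / 2).toNat, by omega⟩, ?_⟩
    convert hx using 2
    simp only
    omega
  have hpt : ∀ x, a x + b x ≤ (if x ∈ O then 1 else 0) + if x ∈ E then 1 else 0 := by
    intro x
    have h2x := h2 x
    have hm : ∀ t, -a x ≤ t → t < b x → x ∈ A t := fun t h1 h2 => ⟨h1, h2⟩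
    have n1 : (0 : ℤ) ≤ if x ∈ O then 1 else 0 := by split_ifs <;> simp
    have n2 : (0 : ℤ) ≤ if x ∈ E then 1 else 0 := by split_ifs <;> simp
    rcases le_or_gt (a x + b x) 0 with h | h
    · omega
    rcases Int.emod_two_eq_zero_or_one (-a x - M) with hp | hp
    · rw [if_pos (hmemE x _ (hm (-a x) le_rfl (by omega)) hp)] at *
      rcases lt_or_ge (a x + b x) 2 with h' | h'
      · omega
      · rw [if_pos (hmemO x _ (hm (-a x + 1) (by omega) (by omega)) (by omega))]
        omega
    · rw [if_pos (hmemO x _ (hm (-a x) le_rfl (by omega)) hp)] at *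
      rcases lt_or_ge (a x + b x) 2 with h' | h'
      · omega
      · rw [if_pos (hmemE x _ (hm (-a x + 1) (by omega) (by omega)) (by omega))]
        omega
  have hdual : ∑ x, (a x + b (σ x)) ≤ O.ncard + E.ncard := by
    have hcount : ∀ s : Set V, (∑ x, if x ∈ s then (1 : ℤ) else 0) = s.ncard := fun s => by
      rw [Finset.sum_boole, ← Set.ncard_coe_finset]
      congr 2
      ext x
      simp
    rw [Finset.sum_add_distrib, Equiv.sum_comp σ b, ← Finset.sum_add_distrib, ← hcount O,
      ← hcount E, ← Finset.sum_add_distrib]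
    exact Finset.sum_le_sum fun x _ => hpt x
  have hnorm : ((knorm f k + knorm f (k + 1) : ℕ) : ℤ) ≤ ∑ x, (a x + b (σ x)) := by
    unfold knorm
    rw [← Finset.sum_add_distrib, Nat.cast_sum]
    refine Finset.sum_le_sum fun z _ => ?_
    rw [hσ z]
    rcases (f ⁻¹' {z}).eq_empty_or_nonempty with h | ⟨x, hx⟩
    · rw [h]
      simp only [Set.ncard_empty]
      split_ifs <;> simp
      omega
    · have hx' : f x = z := hx
      have ht := hterm x
      rw [hx'] at ht
      split_ifs with h1
      · have hsub : f ⁻¹' {z} ⊆ {z} := fun y hy => by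
          have hy' : f y = z := hy
          have := hfix y (by rw [hy', ← h1])
          exact this.trans hy'
        have := Set.ncard_le_ncard hsub
        rw [Set.ncard_singleton] at this
        push_cast
        omega
      · push_cast
        omega
  have hk1 := alphak_le_knorm hpart k
  have hk2 := alphak_le_knorm hpart (k + 1)
  exact ⟨f, hpart, by omega, by omega⟩

lemma sgk_of_strictOrder [Fintype V] {G : SimpleGraph V}
    (hirr : ∀ x, ¬ lt x x) (htr : ∀ x y z, lt x y → lt y z → lt x z)
    (hG : ∀ x y, G.Adj x y ↔ lt x y ∨ lt y x) : SGK G := fun s _ hk =>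
  exists_saturated_of_strictOrder (lt := fun x y : (↑s : Set V) => lt x y)
    (fun x => hirr x) (fun x y z => htr x y z) (fun x y => hG x y) hk

lemma isComparabilityGraph_of_strictOrder {G : SimpleGraph V}
    (hirr : ∀ x, ¬ lt x x) (htr : ∀ x y z, lt x y → lt y z → lt x z)
    (hG : ∀ x y, G.Adj x y ↔ lt x y ∨ lt y x) : IsComparabilityGraph G := by
  refine ⟨fun x y => x = y ∨ lt x y, { refl := fun x => Or.inl rfl, trans := ?_, antisymm := ?_ },
    fun v w => ?_⟩
  · rintro x y z (rfl | h1) (rfl | h2)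
    · exact Or.inl rfl
    · exact Or.inr h2
    · exact Or.inr h1
    · exact Or.inr (htr _ _ _ h1 h2)
  · rintro x y (rfl | h1) (h | h2)
    · rfl
    · rfl
    · exact h.symm
    · exact absurd (htr _ _ _ h1 h2) (hirr x)
  · rw [hG]
    constructor
    · intro h
      refine ⟨?_, h.imp Or.inr Or.inr⟩
      rintro rfl
      exact hirr _ (h.elim id id)
    · rintro ⟨hne, (h | h) | (h | h)⟩
      · exact absurd h hne
      · exact Or.inl h
      · exact absurd h.symm hne
      · exact Or.inr h

end GreeneKleitman

section Ladder

variable {V : Type*}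

/-- The strict order of a ladder poset in terms of columns and ranks. Column `i` consists of a chain
of ranks `1, …, i - 1`, a spine vertex of rank `i + 1` and a top vertex of rank `0`. -/
def ladderLT (col : V → ℤ) (rank : V → ℕ) (x y : V) : Prop :=
  0 < rank x ∧ ((col x ≤ col y ∧ rank y = 0) ∨ (col x < col y ∧ col y < rank y) ∨
    (col x = col y ∧ rank x < rank y))

/-- The coordinates of a ladder with columns `0, …, c - 2` and some isolated vertices, which are
placed in negative columns. -/
structure IsLadder (c : ℕ) (col : V → ℤ) (rank : V → ℕ) : Prop where
  ext : ∀ x y, col x = col y → rank x = rank y → x = y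
  bounds : ∀ x, (0 ≤ col x ∧ col x + 2 ≤ c ∧ rank x ≤ col x + 1 ∧ rank x ≠ col x) ∨
    (col x < 0 ∧ rank x = 0)
  exists_vertex : ∀ i r : ℕ, i + 2 ≤ c → r ≤ i + 1 → r ≠ i → ∃ x, col x = i ∧ rank x = r

lemma ladderLT_irrefl (col : V → ℤ) (rank : V → ℕ) (x : V) : ¬ ladderLT col rank x x := by
  unfold ladderLT
  omega

lemma ladderLT_trans (col : V → ℤ) (rank : V → ℕ) (x y z : V) (hxy : ladderLT col rank x y)
    (hyz : ladderLT col rank y z) : ladderLT col rank x z := by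
  unfold ladderLT at *
  omega

/-- The comparability graph of the ladder poset. -/
def ladderGraph (col : V → ℤ) (rank : V → ℕ) : SimpleGraph V where
  Adj x y := ladderLT col rank x y ∨ ladderLT col rank y x
  symm := ⟨fun _ _ h => h.symm⟩
  loopless := ⟨fun x h => ladderLT_irrefl col rank x (h.elim id id)⟩

lemma le_ncard_of_forall_exists [Finite V] {S : Set V} {ρ : V → ℕ} {k : ℕ}
    (h : ∀ r < k, ∃ y ∈ S, ρ y = r) : k ≤ S.ncard := by
  calc k = (Finset.range k : Set ℕ).ncard := by rw [Set.ncard_coe_finset, Finset.card_range]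
    _ ≤ (ρ '' S).ncard := Set.ncard_le_ncard (fun r hr => by
        obtain ⟨y, hy, hyr⟩ := h r (Finset.mem_range.1 (Finset.mem_coe.1 hr))
        exact ⟨y, hy, hyr⟩) (Set.toFinite _)
    _ ≤ S.ncard := Set.ncard_image_le (Set.toFinite _)

namespace IsLadder

variable {c : ℕ} {col : V → ℤ} {rank : V → ℕ}

lemma rank_ne_of_adj (h : IsLadder c col rank) (x y : V) (hxy : (ladderGraph col rank).Adj x y) :
    rank x ≠ rank y := by
  have h1 := h.bounds x
  have h2 := h.bounds y
  rcases hxy with hxy | hxy <;> unfold ladderLT at hxy <;> omega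

lemma adj_of_rank_ne {f : V → V} (hf : IsCliquePartition (ladderGraph col rank) f) {x y : V}
    (hxy : f x = f y) (hr : rank x ≠ rank y) : ladderLT col rank x y ∨ ladderLT col rank y x :=
  hf (f y) hxy rfl fun e => hr (e ▸ rfl)

lemma cliqueNumber_eq [Fintype V] (h : IsLadder c col rank) (hc : 3 ≤ c) :
    cliqueNumber (ladderGraph col rank) = c := by
  apply le_antisymm
  · obtain ⟨Q, hQ, hQc⟩ := exists_isClique_ncard_eq (ladderGraph col rank)
    rw [← hQc, ← Finset.card_range c, ← Set.ncard_coe_finset]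
    refine Set.ncard_le_ncard_of_injOn rank (fun x _ => ?_) (fun x hx y hy hxy => ?_)
      (Finset.finite_toSet _)
    · have := h.bounds x
      exact Finset.mem_coe.2 (Finset.mem_range.2 (by omega))
    · by_contra hne
      exact h.rank_ne_of_adj x y (hQ hx hy hne) hxy
  · let S : Set V := {x | (0 ≤ col x ∧ rank x = col x + 1) ∨ (col x + 2 = c ∧ rank x = 0)}
    have hS : (ladderGraph col rank).IsClique S := by
      intro x hx y hy hxy
      have hx' : (0 ≤ col x ∧ rank x = col x + 1) ∨ (col x + 2 = c ∧ rank x = 0) := hx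
      have hy' : (0 ≤ col y ∧ rank y = col y + 1) ∨ (col y + 2 = c ∧ rank y = 0) := hy
      have h1 := h.bounds x
      have h2 := h.bounds y
      have h3 : col x ≠ col y ∨ rank x ≠ rank y := by
        by_contra! hcon
        exact hxy (h.ext x y hcon.1 hcon.2)
      change ladderLT col rank x y ∨ ladderLT col rank y x
      unfold ladderLT
      omega
    refine (le_ncard_of_forall_exists (S := S) (ρ := rank) fun r hr => ?_).trans
      (le_csSup (bddAbove_cliqueNumber _) ⟨S, hS, rfl⟩)
    rcases Nat.eq_zero_or_pos r with rfl | hpos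
    · obtain ⟨x, hx, hr⟩ := h.exists_vertex (c - 2) 0 (by omega) (by omega) (by omega)
      exact ⟨x, Or.inr ⟨by omega, hr⟩, hr⟩
    · obtain ⟨x, hx, hr⟩ := h.exists_vertex (r - 1) r (by omega) (by omega) (by omega)
      exact ⟨x, Or.inl ⟨by omega, by omega⟩, hr⟩

/-- The spine up to column `m` together with the top vertex of column `m`, all the later columns,
and otherwise singletons: a clique partition that is `m`- and `m + 1`-saturated. -/
lemma exists_partition (h : IsLadder c col rank) {m : ℕ} (hm : 0 < m) (hmc : m + 2 ≤ c) :
    ∃ f : V → V, IsCliquePartition (ladderGraph col rank) f ∧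
      ∀ k, m ≤ k → k ≤ m + 1 → ∀ z, f ⁻¹' {z} ⊆ {x | rank x < k} ∨
        ∀ r < k, ∃ y ∈ f ⁻¹' {z} ∩ {x | rank x < k}, rank y = r := by
  have hex : ∀ x, ∃ y,
      ((m < col x ∨ (col x = m ∧ (rank x = 0 ∨ rank x = m + 1))) ∧ col y = col x ∧ rank y = 0) ∨
      ((0 ≤ col x ∧ col x < m ∧ rank x = col x + 1) ∧ col y = m ∧ rank y = 0) ∨
      ((col x < 0 ∨ col x < m ∧ rank x ≠ col x + 1 ∨ col x = m ∧ rank x ≠ 0 ∧ rank x ≠ m + 1) ∧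
        col y = col x ∧ rank y = rank x) := by
    intro x
    have hx := h.bounds x
    by_cases h1 : m < col x ∨ (col x = m ∧ (rank x = 0 ∨ rank x = m + 1))
    · obtain ⟨y, hy, hy'⟩ := h.exists_vertex (col x).toNat 0 (by omega) (by omega) (by omega)
      exact ⟨y, Or.inl ⟨h1, by omega, hy'⟩⟩
    · by_cases h2 : 0 ≤ col x ∧ col x < m ∧ rank x = col x + 1
      · obtain ⟨y, hy, hy'⟩ := h.exists_vertex m 0 (by omega) (by omega) (by omega)
        exact ⟨y, Or.inr (Or.inl ⟨h2, hy, hy'⟩)⟩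
      · exact ⟨x, Or.inr (Or.inr ⟨by omega, rfl, rfl⟩)⟩
  choose f hf using hex
  refine ⟨f, fun z x hx y hy hxy => ?_, fun k hk1 hk2 z => ?_⟩
  · have hx' : f x = z := hx
    have hy' : f y = z := hy
    have h1 := hf x
    have h2 := hf y
    rw [hx'] at h1
    rw [hy'] at h2
    have h3 := h.bounds x
    have h4 := h.bounds y
    have h5 : col x ≠ col y ∨ rank x ≠ rank y := by
      by_contra! hcon
      exact hxy (h.ext x y hcon.1 hcon.2)
    change ladderLT col rank x y ∨ ladderLT col rank y x
    unfold ladderLT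
    omega
  · by_cases hsub : f ⁻¹' {z} ⊆ {x | rank x < k}
    · exact Or.inl hsub
    · right
      obtain ⟨x, hx, hxk⟩ := Set.not_subset.1 hsub
      have hx' : f x = z := hx
      have hxk' : ¬ rank x < k := hxk
      have h1 := hf x
      rw [hx'] at h1
      have h2 := h.bounds x
      have hz : m ≤ col z ∧ col z + 2 ≤ c ∧ rank z = 0 := by omega
      intro r hr
      suffices hy : ∃ y, rank y = r ∧
          ((col y = col z ∧ (r = 0 ∨ m < col z)) ∨ (col z = m ∧ col y + 1 = r ∧ 0 < r)) by
        obtain ⟨y, hyr, hy⟩ := hy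
        refine ⟨y, ⟨?_, show rank y < k by omega⟩, hyr⟩
        have h3 := hf y
        exact h.ext _ _ (by omega) (by omega)
      rcases Nat.eq_zero_or_pos r with rfl | hpos
      · exact ⟨z, hz.2.2, Or.inl ⟨rfl, Or.inl rfl⟩⟩
      · rcases hz.1.lt_or_eq with hlt | heq
        · obtain ⟨y, hy, hyr⟩ := h.exists_vertex (col z).toNat r (by omega) (by omega) (by omega)
          exact ⟨y, hyr, Or.inl ⟨by omega, Or.inr hlt⟩⟩
        · obtain ⟨y, hy, hyr⟩ := h.exists_vertex (r - 1) r (by omega) (by omega) (by omega)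
          exact ⟨y, hyr, Or.inr ⟨heq.symm, by omega, hpos⟩⟩

lemma alphak_le [Fintype V] (h : IsLadder c col rank) (hc : 3 ≤ c) {k : ℕ} (hk : 0 < k)
    (hkc : k < c) : alphak (ladderGraph col rank) k ≤ {x | rank x < k}.ncard := by
  obtain ⟨f, hf, hfk⟩ := h.exists_partition (m := min k (c - 2)) (by omega) (by omega)
  exact (alphak_le_knorm hf k).trans (knorm_le_ncard_of_fibers fun z =>
    (hfk k (by omega) (by omega) z).imp_right le_ncard_of_forall_exists)

lemma not_saturated [Fintype V] (h : IsLadder c col rank) {k l : ℕ} (hk : 0 < k)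
    (hkl : k + 2 ≤ l) (hlc : l < c) {f : V → V}
    (hf : IsCliquePartition (ladderGraph col rank) f)
    (hfk : knorm f k = alphak (ladderGraph col rank) k)
    (hfl : knorm f l = alphak (ladderGraph col rank) l) : False := by
  have hck : ∀ x, k ≤ rank x → ∃ y, f y = f x ∧ rank y = 0 := fun x hx =>
    exists_color_of_knorm_le hf h.rank_ne_of_adj
      (hfk.trans_le (h.alphak_le (by omega) hk (by omega))) hx hk
  have hcl : ∀ x, l ≤ rank x → ∀ r < l, ∃ y, f y = f x ∧ rank y = r := fun x hx r hr =>
    exists_color_of_knorm_le hf h.rank_ne_of_adj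
      (hfl.trans_le (h.alphak_le (by omega) (by omega) hlc)) hx hr
  have htop : ∀ t i : ℕ, i + t + 2 = c → k < i → ∀ x y, col x = i → rank x + 1 = i →
      col y = i → rank y = 0 → f y = f x := by
    intro t
    induction t using Nat.strong_induction_on with
    | _ t ih =>
      intro i hit hki x y hx hxr hy hyr
      obtain ⟨u, hu, hur⟩ := hck x (by omega)
      have hub := h.bounds u
      have hadj := adj_of_rank_ne hf hu.symm (by omega)
      have hiu : (i : ℤ) ≤ col u := by
        unfold ladderLT at hadj
        omega
      rcases hiu.lt_or_eq with hlt | heq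
      · obtain ⟨v, hv, hvr⟩ := h.exists_vertex (col u).toNat ((col u).toNat - 1)
          (by omega) (by omega) (by omega)
        have huv := ih (c - 2 - (col u).toNat) (by omega) (col u).toNat (by omega) (by omega) v u
          hv (by omega) (by omega) hur
        have hadj' := adj_of_rank_ne hf (hu.symm.trans huv) (by omega)
        unfold ladderLT at hadj'
        omega
      · rw [h.ext y u (by omega) (by omega), hu]
  obtain ⟨w, hw, hwr⟩ := h.exists_vertex (l - 1) l (by omega) (by omega) (by omega)
  obtain ⟨u, hu, hur⟩ := hcl w (by omega) 0 (by omega)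
  have hub := h.bounds u
  have hwu := adj_of_rank_ne hf hu.symm (by omega)
  have hlu : (l : ℤ) - 1 ≤ col u := by
    unfold ladderLT at hwu
    omega
  obtain ⟨v, hv, hvr⟩ := h.exists_vertex (col u).toNat ((col u).toNat - 1)
    (by omega) (by omega) (by omega)
  have huv := htop (c - 2 - (col u).toNat) (col u).toNat (by omega) (by omega) v u hv (by omega)
    (by omega) hur
  have hul : col u = (l : ℤ) - 1 := by
    by_contra hne
    have hadj := hf (f u) (show w ∈ f ⁻¹' {f u} from hu.symm)
      (show v ∈ f ⁻¹' {f u} from huv.symm) (by rintro rfl; omega)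
    change ladderLT col rank w v ∨ ladderLT col rank v w at hadj
    unfold ladderLT at hadj
    omega
  obtain ⟨y, hy, hyr⟩ := hcl w (by omega) (l - 1) (by omega)
  have hyb := h.bounds y
  have hadj := adj_of_rank_ne hf (huv.symm.trans (hu.trans hy.symm)) (by omega)
  unfold ladderLT at hadj
  omega

lemma polyunsatG [Fintype V] (h : IsLadder c col rank) (hc : 3 ≤ c) :
    PolyunsatG (ladderGraph col rank) := by
  intro k l hk hl hkc hlc hkl ⟨f, hf, hfk, hfl⟩
  rw [h.cliqueNumber_eq hc] at hkc hlc
  rcases hkl with hkl | hkl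
  · exact h.not_saturated hk hkl hlc hf hfk hfl
  · exact h.not_saturated hl hkl hkc hf hfl hfk

lemma isComparabilityGraph_compl (h : IsLadder c col rank) :
    IsComparabilityGraph (ladderGraph col rank)ᶜ := by
  refine isComparabilityGraph_of_strictOrder
    (lt := fun x y => col x < col y ∧ ¬ ladderLT col rank x y) (fun x hx => lt_irrefl _ hx.1)
    (fun x y z hxy hyz => ?_) fun x y => ?_
  · unfold ladderLT at *
    omega
  · have h1 := h.bounds x
    have h2 := h.bounds y
    rw [SimpleGraph.compl_adj]
    change x ≠ y ∧ ¬ (ladderLT col rank x y ∨ ladderLT col rank y x) ↔ _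
    by_cases hxy : x = y
    · subst hxy
      simp
    · have h3 : col x ≠ col y ∨ rank x ≠ rank y := by
        by_contra! hcon
        exact hxy (h.ext x y hcon.1 hcon.2)
      simp only [ne_eq, hxy, not_false_eq_true, true_and]
      unfold ladderLT
      omega

end IsLadder

lemma sum_range_add_one_eq_choose_two (m : ℕ) :
    ∑ i ∈ Finset.range m, (i + 1) = (m + 1).choose 2 := by
  induction m with
  | zero => rfl
  | succ m ih =>
    rw [Finset.sum_range_succ, ih, Nat.choose_succ_succ' (m + 1) 1, Nat.choose_one_right, add_comm]

lemma exists_isLadder {n c : ℕ} (hc : 3 ≤ c) (hn : c.choose 2 ≤ n) :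
    ∃ (col : Fin n → ℤ) (rank : Fin n → ℕ), IsLadder c col rank := by
  let W := (Σ i : Fin (c - 1), Fin (i + 1)) ⊕ Fin (n - c.choose 2)
  have hcard : Fintype.card (Fin n) = Fintype.card W := by
    simp only [W, Fintype.card_sum, Fintype.card_sigma, Fintype.card_fin]
    rw [Fin.sum_univ_eq_sum_range (fun i => i + 1), sum_range_add_one_eq_choose_two,
      show c - 1 + 1 = c by omega]
    omega
  let e := Fintype.equivOfCardEq hcard
  let colW : W → ℤ := Sum.elim (fun p => (p.1 : ℕ)) (fun j => -1 - (j : ℕ))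
  let rankW : W → ℕ := Sum.elim
    (fun p => if (p.2 : ℕ) < p.1 then (p.2 : ℕ) else p.2 + 1) (fun _ => 0)
  suffices h : IsLadder c colW rankW from
    ⟨colW ∘ e, rankW ∘ e, fun x y h1 h2 => e.injective (h.ext _ _ h1 h2), fun x => h.bounds _,
      fun i r h1 h2 h3 => by
        obtain ⟨x, hx⟩ := h.exists_vertex i r h1 h2 h3
        exact ⟨e.symm x, by simpa using hx⟩⟩
  refine ⟨?_, ?_, ?_⟩
  · rintro (⟨⟨i, hi⟩, ⟨a, ha⟩⟩ | ⟨i, hi⟩) (⟨⟨j, hj⟩, ⟨b, hb⟩⟩ | ⟨j, hj⟩) h1 h2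
    · simp only [colW, rankW, Sum.elim_inl] at h1 h2 ha hb
      obtain rfl : i = j := by omega
      obtain rfl : a = b := by split_ifs at h2 <;> omega
      rfl
    · simp only [colW, Sum.elim_inl, Sum.elim_inr] at h1
      omega
    · simp only [colW, Sum.elim_inl, Sum.elim_inr] at h1
      omega
    · simp only [colW, Sum.elim_inr] at h1
      obtain rfl : i = j := by omega
      rfl
  · rintro (⟨⟨i, hi⟩, ⟨a, ha⟩⟩ | ⟨i, hi⟩)
    · left
      simp only [colW, rankW, Sum.elim_inl] at ha ⊢
      split_ifs <;> omega
    · right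
      change -1 - (i : ℤ) < 0 ∧ 0 = 0
      omega
  · intro i r h1 h2 h3
    refine ⟨Sum.inl ⟨⟨i, by omega⟩, ⟨min r i, by simp only; omega⟩⟩, rfl, ?_⟩
    simp only [rankW, Sum.elim_inl]
    split_ifs <;> omega

end Ladder

/-- For positive integers `n` and `c` with `c ≥ 3`: there is an `n`-vertex
polyunsaturated SGK graph with clique number `c` iff `n ≥ c.choose 2`; moreover, in that
case the graph may be chosen so that it and its complement are comparability graphs. -/
theorem statement14 (n c : ℕ) (hn : 0 < n) (hc : 3 ≤ c) :
    ((∃ G : SimpleGraph (Fin n), SGK G ∧ PolyunsatG G ∧ cliqueNumber G = c) ↔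
      c.choose 2 ≤ n) ∧
    (c.choose 2 ≤ n →
      ∃ G : SimpleGraph (Fin n),
        SGK G ∧ PolyunsatG G ∧ cliqueNumber G = c ∧
        IsComparabilityGraph G ∧ IsComparabilityGraph Gᶜ) := by
  have key : c.choose 2 ≤ n → ∃ G : SimpleGraph (Fin n), SGK G ∧ PolyunsatG G ∧
      cliqueNumber G = c ∧ IsComparabilityGraph G ∧ IsComparabilityGraph Gᶜ := by
    intro h
    obtain ⟨col, rank, hl⟩ := exists_isLadder hc h
    have hirr := ladderLT_irrefl col rank
    have htr := ladderLT_trans col rank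
    exact ⟨ladderGraph col rank, sgk_of_strictOrder hirr htr fun _ _ => Iff.rfl,
      hl.polyunsatG hc, hl.cliqueNumber_eq hc,
      isComparabilityGraph_of_strictOrder hirr htr fun _ _ => Iff.rfl,
      hl.isComparabilityGraph_compl⟩
  refine ⟨⟨?_, fun h => ?_⟩, key⟩
  · rintro ⟨G, hS, hP, hω⟩
    simpa using choose_two_le_card_of_polyunsat hc hS hP hω
  · obtain ⟨G, hS, hP, hω, -⟩ := key h
    exact ⟨G, hS, hP, hω⟩
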